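/- arXiv:1101.2075 — 2 statements merged into one kernel-verified Lean document; each statement's English description precedes it below -/
import Mathlib

section
/- Let w₀ be the longest element of W. Then, in ℂW, w₀ = ∑_{K ⊆ S} (−1)^{|K|} x_K = ∑_{L ⊆ S} (−1)^{|L|} e_L. In particular w₀ lies in Solomon's descent algebra Σ(W), and w₀ = ∑_{λ ∈ Λ} (−1)^{d_λ} e_λ, where for each shape λ, d_λ = |L| for any L ∈ S_λ and e_λ = ∑_{I ∈ S_λ} e_I. -/
open scoped Classical
open MonoidAlgebra Finset

noncomputable section

namespace DPR

variable {B : Type} {W : Type} [Group W] [Fintype W] [DecidableEq W]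
  {M : CoxeterMatrix B}

/-- The set `S` of simple reflections of the Coxeter system, as a finset of `W`. -/
def Simples (cs : CoxeterSystem M W) : Finset W :=
  Finset.univ.filter (fun w => ∃ i, cs.simple i = w)

/-- The set `W^I` of minimal length left coset representatives of `W_I`,
computed inside the subset `H` of `W` (take `H = Set.univ` for the absolute case). -/
def minCoset (cs : CoxeterSystem M W) (H : Set W) (I : Finset W) : Finset W :=
  Finset.univ.filter (fun w => w ∈ H ∧ ∀ s ∈ I, cs.length w < cs.length (w * s))

/-- The element `x_I = ∑_{w ∈ W^I} w` of the group algebra `ℂ W`, relative to `H`. -/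
def xRel (cs : CoxeterSystem M W) (H : Set W) (I : Finset W) : MonoidAlgebra ℂ W :=
  ∑ w ∈ minCoset cs H I, of ℂ W w

/-- `w(Δ_J) ⊆ Δ_D`:  for every `s ∈ J`, `wsw⁻¹ ∈ D` and `ℓ(ws) = ℓ(w) + 1`. -/
def Takes (cs : CoxeterSystem M W) (D : Finset W) (w : W) (J : Finset W) : Prop :=
  ∀ s ∈ J, w * s * w⁻¹ ∈ D ∧ cs.length (w * s) = cs.length w + 1

/-- `ᵂJ = wJw⁻¹`. -/
def conjF (w : W) (J : Finset W) : Finset W := J.image (fun s => w * s * w⁻¹)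

/-- The coefficient `m^σ_{JK}`, computed relative to the pair `(H, D)`
(`H = Set.univ`, `D = S` in the absolute case). -/
def mC (cs : CoxeterSystem M W) (H : Set W) (D : Finset W) (σ : Finset W → ℝ)
    (J K : Finset W) : ℝ :=
  if J ⊆ K then
    ∑ w ∈ (minCoset cs H K).filter (fun w => Takes cs D w J), σ (conjF w J)
  else 0

/-- The family `(e_J)` is a family of BBHT quasi-idempotents, relative to `(H, D, σ)`:
it solves the defining triangular system `x_K = ∑_{J ⊆ K} m^σ_{JK} e_J` for all `K ⊆ D`. -/
def IsBBHT (cs : CoxeterSystem M W) (H : Set W) (D : Finset W) (σ : Finset W → ℝ)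
    (e : Finset W → MonoidAlgebra ℂ W) : Prop :=
  ∀ K ∈ D.powerset, xRel cs H K = ∑ J ∈ K.powerset, (mC cs H D σ J K : ℂ) • e J

/-- `σ` takes positive values (on subsets of `D`). -/
def PosOn (D : Finset W) (σ : Finset W → ℝ) : Prop := ∀ I ∈ D.powerset, 0 < σ I

/-- Two subsets of `S` have the same shape if the parabolic subgroups they generate
are conjugate in `W`. -/
def ShapeEq (I J : Finset W) : Prop :=
  ∃ w : W, Subgroup.closure (J : Set W) =
    Subgroup.map (MulAut.conj w).toMonoidHom (Subgroup.closure (I : Set W))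

/-- Solomon's descent algebra, as a subspace of the group algebra: the span of the `x_I`. -/
def descAlg (cs : CoxeterSystem M W) : Submodule ℂ (MonoidAlgebra ℂ W) :=
  Submodule.span ℂ {a | ∃ I ∈ (Simples cs).powerset, a = xRel cs Set.univ I}

/-- The action of a simple reflection on pairs of a group element and a sign, recording
whether the element is that simple reflection. -/
def signAct (cs : CoxeterSystem M W) (i : B) : Function.End (W × ZMod 2) :=
  fun p => (cs.simple i * p.1 * cs.simple i, p.2 + if p.1 = cs.simple i then 1 else 0)

theorem signAct_mul_pow (cs : CoxeterSystem M W) (i j : B) (k : ℕ) (p : W × ZMod 2) :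
    ((signAct cs i * signAct cs j) ^ k) p =
      ((cs.simple i * cs.simple j) ^ k * p.1 * ((cs.simple i * cs.simple j) ^ k)⁻¹,
        p.2 + ∑ l ∈ range (2 * k),
          if p.1 = (cs.simple j * cs.simple i) ^ l * cs.simple j then 1 else 0) := by
  have hinv : cs.simple j * cs.simple i = (cs.simple i * cs.simple j)⁻¹ := by simp
  have hconj : ∀ n : ℕ, cs.simple j * (cs.simple i * cs.simple j) ^ n =
      (cs.simple j * cs.simple i) ^ n * cs.simple j := by
    intro n
    induction n with
    | zero => simp
    | succ n ih => rw [pow_succ, ← mul_assoc, ih, pow_succ]; simp only [mul_assoc]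
  induction k with
  | zero => simp; rfl
  | succ k ih =>
    rw [pow_succ', show ((signAct cs i * signAct cs j) * (signAct cs i * signAct cs j) ^ k) p =
      signAct cs i (signAct cs j (((signAct cs i * signAct cs j) ^ k) p)) from rfl, ih]
    have h1 : ((cs.simple i * cs.simple j) ^ k * p.1 * ((cs.simple i * cs.simple j) ^ k)⁻¹ =
        cs.simple j) ↔ p.1 = (cs.simple j * cs.simple i) ^ (2 * k) * cs.simple j := by
      rw [mul_inv_eq_iff_eq_mul, ← eq_inv_mul_iff_mul_eq, hconj, two_mul, pow_add, ← inv_pow,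
        ← hinv, mul_assoc]
    have h2 : (cs.simple j * ((cs.simple i * cs.simple j) ^ k * p.1 *
        ((cs.simple i * cs.simple j) ^ k)⁻¹) * cs.simple j = cs.simple i) ↔
        p.1 = (cs.simple j * cs.simple i) ^ (2 * k + 1) * cs.simple j := by
      have h3 : (cs.simple j * cs.simple i) ^ (2 * k + 1) * cs.simple j =
          ((cs.simple i * cs.simple j) ^ k)⁻¹ * (cs.simple j * cs.simple i * cs.simple j) *
            (cs.simple i * cs.simple j) ^ k := by
        rw [← inv_pow, ← hinv, mul_assoc _ _ (_ ^ k), mul_assoc _ _ (_ ^ k), hconj,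
          show 2 * k + 1 = k + (1 + k) by ring, pow_add, pow_add, pow_one]
        simp only [mul_assoc]
      rw [h3]
      generalize (cs.simple i * cs.simple j) ^ k = r
      constructor
      · intro h
        rw [← h]
        simp [mul_assoc]
      · intro h
        rw [h]
        simp [mul_assoc]
    simp only [signAct, h1, h2]
    rw [show 2 * (k + 1) = 2 * k + 1 + 1 by ring, sum_range_succ, sum_range_succ]
    ext
    · simp [pow_succ', mul_assoc]
    · simp only [add_assoc]

theorem isLiftable_signAct (cs : CoxeterSystem M W) : M.IsLiftable (signAct cs) := by
  intro i j
  funext p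
  rw [signAct_mul_pow, two_mul, sum_range_add]
  simp only [pow_add, cs.simple_mul_simple_pow, cs.simple_mul_simple_pow', one_mul]
  rw [CharTwo.add_self_eq_zero]
  simp
  rfl

/-- The parity with which `t` occurs as a right inversion of `w`. -/
def invParity (cs : CoxeterSystem M W) (w t : W) : ZMod 2 :=
  (cs.lift ⟨signAct cs, isLiftable_signAct cs⟩ w (t, 0)).2

theorem lift_signAct_wordProd (cs : CoxeterSystem M W) (ω : List B) (p : W × ZMod 2) :
    cs.lift ⟨signAct cs, isLiftable_signAct cs⟩ (cs.wordProd ω) p =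
      (cs.wordProd ω * p.1 * (cs.wordProd ω)⁻¹,
        p.2 + ((cs.rightInvSeq ω).count p.1 : ZMod 2)) := by
  induction ω with
  | nil => simp; rfl
  | cons i ω ih =>
    rw [cs.wordProd_cons, map_mul, cs.lift_apply_simple]
    change signAct cs i (cs.lift ⟨signAct cs, isLiftable_signAct cs⟩ (cs.wordProd ω) p) = _
    rw [ih]
    have h : cs.wordProd ω * p.1 * (cs.wordProd ω)⁻¹ = cs.simple i ↔
        (cs.wordProd ω)⁻¹ * cs.simple i * cs.wordProd ω = p.1 := by
      constructor
      · intro h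
        rw [← h]
        simp [mul_assoc]
      · intro h
        rw [← h]
        simp [mul_assoc]
    ext
    · simp [signAct, mul_assoc]
    · simp [signAct, CoxeterSystem.rightInvSeq, List.count_cons, h, add_assoc]

theorem invParity_wordProd (cs : CoxeterSystem M W) (ω : List B) (t : W) :
    invParity cs (cs.wordProd ω) t = (cs.rightInvSeq ω).count t := by
  simp [invParity, lift_signAct_wordProd]

theorem invParity_mul (cs : CoxeterSystem M W) (v w t : W) :
    invParity cs (v * w) t = invParity cs w t + invParity cs v (w * t * w⁻¹) := by
  obtain ⟨ω, rfl⟩ := cs.wordProd_surjective w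
  obtain ⟨υ, rfl⟩ := cs.wordProd_surjective v
  rw [invParity, map_mul]
  change (cs.lift ⟨signAct cs, isLiftable_signAct cs⟩ _
    (cs.lift ⟨signAct cs, isLiftable_signAct cs⟩ _ _)).2 = _
  simp [lift_signAct_wordProd, invParity_wordProd]

theorem invParity_one (cs : CoxeterSystem M W) (t : W) : invParity cs 1 t = 0 := by
  simpa using invParity_wordProd cs [] t

theorem invParity_simple (cs : CoxeterSystem M W) (i : B) :
    invParity cs (cs.simple i) (cs.simple i) = 1 := by
  simpa using invParity_wordProd cs [i] (cs.simple i)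

theorem invParity_self (cs : CoxeterSystem M W) {t : W} (ht : cs.IsReflection t) :
    invParity cs t t = 1 := by
  obtain ⟨v, i, rfl⟩ := ht
  have h := invParity_mul cs v v⁻¹ (v * cs.simple i * v⁻¹)
  rw [invParity_mul, invParity_mul]
  simp only [mul_inv_cancel, invParity_one, mul_assoc, inv_inv, inv_mul_cancel, mul_one, one_mul,
    inv_mul_cancel_left, cs.simple_mul_simple_self, cs.inv_simple, invParity_simple] at h ⊢
  linear_combination -h

theorem length_mul_lt_of_invParity (cs : CoxeterSystem M W) {w t : W}
    (h : invParity cs w t ≠ 0) : cs.length (w * t) < cs.length w := by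
  obtain ⟨ω, hω, rfl⟩ := cs.exists_isReduced w
  rw [invParity_wordProd] at h
  have hm : t ∈ cs.rightInvSeq ω := by
    by_contra hn
    exact h (by simp [List.count_eq_zero_of_not_mem hn])
  exact (cs.isRightInversion_of_mem_rightInvSeq hω hm).2

theorem length_mul_lt_iff (cs : CoxeterSystem M W) {w t : W} (ht : cs.IsReflection t) :
    cs.length (w * t) < cs.length w ↔ invParity cs w t = 1 := by
  constructor
  · intro h
    by_contra hn
    have h0 : ∀ a : ZMod 2, a ≠ 1 → a = 0 := by decide
    have := invParity_mul cs w t t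
    rw [mul_inv_cancel_right, h0 _ hn, invParity_self cs ht] at this
    have := length_mul_lt_of_invParity cs (w := w * t) (t := t) (by rw [this]; decide)
    rw [mul_assoc, ht.mul_self, mul_one] at this
    omega
  · intro h
    exact length_mul_lt_of_invParity cs (by rw [h]; decide)

/-- The strong exchange condition. -/
theorem mem_rightInvSeq (cs : CoxeterSystem M W) {ω : List B} {t : W} (ht : cs.IsReflection t)
    (h : cs.length (cs.wordProd ω * t) < cs.length (cs.wordProd ω)) :
    t ∈ cs.rightInvSeq ω := by
  rw [length_mul_lt_iff cs ht, invParity_wordProd] at h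
  by_contra hn
  simp [List.count_eq_zero_of_not_mem hn] at h

/-- Every word in the letters `J` can be reduced without leaving `J`. -/
theorem exists_isReduced_of_mem (cs : CoxeterSystem M W) (J : Finset W) (ω : List B)
    (hω : ∀ i ∈ ω, cs.simple i ∈ J) :
    ∃ υ : List B, cs.IsReduced υ ∧ (∀ i ∈ υ, cs.simple i ∈ J) ∧
      cs.wordProd υ = cs.wordProd ω := by
  induction ω using List.reverseRecOn with
  | nil => exact ⟨[], by simp [CoxeterSystem.IsReduced], by simp, rfl⟩
  | append_singleton ω i ih =>
    obtain ⟨υ, hυ, hJ, he⟩ := ih fun k hk => hω k (by simp [hk])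
    rw [cs.wordProd_append, cs.wordProd_singleton, ← he]
    have hυ' : cs.length (cs.wordProd υ) = υ.length := hυ
    rcases cs.length_mul_simple (cs.wordProd υ) i with h | h
    · refine ⟨υ ++ [i], ?_, ?_, by simp [cs.wordProd_append]⟩
      · simp [CoxeterSystem.IsReduced, cs.wordProd_append, h, hυ']
      · intro k hk
        rcases List.mem_append.1 hk with hk | hk
        · exact hJ k hk
        · exact hω k (by simp_all)
    · have hm := mem_rightInvSeq cs (cs.isReflection_simple i)
        (show cs.length (cs.wordProd υ * cs.simple i) < cs.length (cs.wordProd υ) by omega)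
      obtain ⟨j, hj, hji⟩ := List.mem_iff_getElem.mp hm
      have hp := cs.wordProd_mul_getD_rightInvSeq υ j
      rw [List.getD_eq_getElem _ 1 hj, hji] at hp
      rw [cs.length_rightInvSeq] at hj
      refine ⟨υ.eraseIdx j, ?_, fun k hk => hJ k (List.mem_of_mem_eraseIdx hk), hp.symm⟩
      have := List.length_eraseIdx_add_one hj
      simp only [CoxeterSystem.IsReduced, ← hp]
      omega

/-- If every element of `J` is a right descent of `w`, lengths subtract along `J`-words. -/
theorem length_mul_wordProd_of_descents (cs : CoxeterSystem M W) {J : Finset W} {w : W}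
    (hw : ∀ s ∈ J, cs.length (w * s) < cs.length w) (ω : List B) (hω : ∀ i ∈ ω, cs.simple i ∈ J) :
    cs.length (w * cs.wordProd ω) + cs.length (cs.wordProd ω) = cs.length w := by
  obtain ⟨υ, hυ, hJ, he⟩ := exists_isReduced_of_mem cs J ω hω
  rw [← he]
  clear he hω
  induction υ with
  | nil => simp
  | cons i υ ih =>
    have hred : cs.IsReduced υ := hυ.drop 1
    have ih := ih hred fun k hk => hJ k (by simp [hk])
    have h1 : cs.length (cs.wordProd (i :: υ)) = υ.length + 1 := hυ
    have h2 : cs.length (cs.wordProd υ) = υ.length := hred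
    have hi := (length_mul_lt_iff cs (cs.isReflection_simple i)).1 (hw _ (hJ i (by simp)))
    have hn : invParity cs (cs.wordProd υ)⁻¹ (cs.simple i) = 0 := by
      by_contra hc
      have := length_mul_lt_of_invParity cs hc
      rw [← cs.inv_simple i, ← mul_inv_rev, cs.length_inv, cs.length_inv,
        ← cs.wordProd_cons] at this
      omega
    have hm := invParity_mul cs (w * cs.wordProd υ) (cs.wordProd υ)⁻¹ (cs.simple i)
    rw [mul_inv_cancel_right, hi, hn, zero_add, inv_inv] at hm
    have hlt := length_mul_lt_of_invParity cs (by rw [← hm]; decide)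
    rw [show w * cs.wordProd υ * ((cs.wordProd υ)⁻¹ * cs.simple i * cs.wordProd υ) =
      w * cs.wordProd (i :: υ) by simp [cs.wordProd_cons, mul_assoc]] at hlt
    have := cs.length_le_length_mul_add_right w (cs.wordProd (i :: υ))
    omega

theorem mem_simples {cs : CoxeterSystem M W} {w : W} : w ∈ Simples cs ↔ ∃ i, cs.simple i = w := by
  simp [Simples]

/-- The simple right ascents of `w`. -/
def ascents (cs : CoxeterSystem M W) (w : W) : Finset W :=
  (Simples cs).filter fun s => cs.length w < cs.length (w * s)

theorem mem_minCoset_univ_iff (cs : CoxeterSystem M W) {K : Finset W} (hK : K ⊆ Simples cs)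
    (w : W) : w ∈ minCoset cs Set.univ K ↔ K ⊆ ascents cs w := by
  simp only [minCoset, ascents, mem_filter, mem_univ, Set.mem_univ, true_and]
  exact ⟨fun h s hs => mem_filter.2 ⟨hK hs, h s hs⟩, fun h s hs => (mem_filter.1 (h hs)).2⟩

/-- Each standard parabolic subgroup `W_J` has an element with every element of `J` as a
right descent. -/
theorem exists_longest (cs : CoxeterSystem M W) {J : Finset W} (hJ : J ⊆ Simples cs) :
    ∃ ω : List B, (∀ i ∈ ω, cs.simple i ∈ J) ∧
      ∀ s ∈ J, cs.length (cs.wordProd ω * s) < cs.length (cs.wordProd ω) := by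
  obtain ⟨u, hu, hmax⟩ := exists_max_image
    (univ.filter fun u : W => ∃ ω : List B, (∀ i ∈ ω, cs.simple i ∈ J) ∧ cs.wordProd ω = u)
    cs.length ⟨1, mem_filter.2 ⟨mem_univ _, [], by simp, by simp⟩⟩
  obtain ⟨ω, hω, rfl⟩ := (mem_filter.1 hu).2
  refine ⟨ω, hω, fun s hs => ?_⟩
  obtain ⟨i, rfl⟩ := mem_simples.1 (hJ hs)
  refine lt_of_le_of_ne (hmax _ (mem_filter.2 ⟨mem_univ _, ω ++ [i], ?_, ?_⟩))
    (cs.length_mul_simple_ne _ i)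
  · intro k hk
    rcases List.mem_append.1 hk with hk | hk
    · exact hω k hk
    · rw [List.mem_singleton.1 hk]
      exact hs
  · simp [cs.wordProd_append]

/-- A simple right descent of a `J`-word lies in `J`. -/
theorem mem_of_descent (cs : CoxeterSystem M W) {J : Finset W} {ω : List B}
    (hω : ∀ i ∈ ω, cs.simple i ∈ J) {s : W} (hs : s ∈ Simples cs)
    (h : cs.length (cs.wordProd ω * s) < cs.length (cs.wordProd ω)) : s ∈ J := by
  obtain ⟨i, rfl⟩ := mem_simples.1 hs
  obtain ⟨j, hj, hji⟩ := List.mem_iff_getElem.mp (mem_rightInvSeq cs (cs.isReflection_simple i) h)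
  have hp := cs.wordProd_mul_getD_rightInvSeq ω j
  rw [List.getD_eq_getElem _ 1 hj, hji, ← eq_inv_mul_iff_mul_eq, ← cs.wordProd_reverse,
    ← cs.wordProd_append] at hp
  obtain ⟨υ, hυ, hυJ, he⟩ := exists_isReduced_of_mem cs J (ω.reverse ++ ω.eraseIdx j) (by
    intro k hk
    rcases List.mem_append.1 hk with hk | hk
    · exact hω k (List.mem_reverse.1 hk)
    · exact hω k (List.mem_of_mem_eraseIdx hk))
  rw [← hp] at he
  have h1 : cs.length (cs.wordProd υ) = υ.length := hυ
  rw [he, cs.length_simple] at h1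
  obtain ⟨k, rfl⟩ := List.length_eq_one_iff.1 h1.symm
  rw [← he, cs.wordProd_singleton]
  exact hυJ k (by simp)

/-- If conjugation by `x` maps `J` into `S`, it does not lengthen `J`-words. -/
theorem length_conj_wordProd_le (cs : CoxeterSystem M W) {J : Finset W} {x : W}
    (hx : ∀ s ∈ J, x * s * x⁻¹ ∈ Simples cs) (ω : List B) (hω : ∀ i ∈ ω, cs.simple i ∈ J) :
    cs.length (x * cs.wordProd ω * x⁻¹) ≤ cs.length (cs.wordProd ω) := by
  obtain ⟨υ, hυ, hJ, he⟩ := exists_isReduced_of_mem cs J ω hω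
  have h1 : cs.length (cs.wordProd υ) = υ.length := hυ
  rw [← he, h1]
  clear he hω hυ h1
  induction υ with
  | nil => simp
  | cons i υ ih =>
    have ih := ih fun k hk => hJ k (by simp [hk])
    obtain ⟨k, hk⟩ := mem_simples.1 (hx _ (hJ i (by simp)))
    have := cs.length_mul_le (x * cs.simple i * x⁻¹) (x * cs.wordProd υ * x⁻¹)
    rw [← hk, cs.length_simple, hk] at this
    rw [show x * cs.wordProd (i :: υ) * x⁻¹ = x * cs.simple i * x⁻¹ * (x * cs.wordProd υ * x⁻¹) by
      simp [cs.wordProd_cons, mul_assoc], List.length_cons]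
    omega

/-- If every element of `J` is a right descent of the `J`-word `ω`, then `ω` represents an
involution. -/
theorem wordProd_mul_self_of_descents (cs : CoxeterSystem M W) {J : Finset W} {ω : List B}
    (hω : ∀ i ∈ ω, cs.simple i ∈ J)
    (hd : ∀ s ∈ J, cs.length (cs.wordProd ω * s) < cs.length (cs.wordProd ω)) :
    cs.wordProd ω * cs.wordProd ω = 1 := by
  have := length_mul_wordProd_of_descents cs hd ω hω
  exact cs.length_eq_zero_iff.1 (by omega)

/-- Conjugation by the longest element of `W_J` preserves simple reflections in `J`. -/
theorem conj_mem_simples_of_descents (cs : CoxeterSystem M W) {J : Finset W}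
    (hJ : J ⊆ Simples cs) {ω : List B} (hω : ∀ i ∈ ω, cs.simple i ∈ J)
    (hd : ∀ s ∈ J, cs.length (cs.wordProd ω * s) < cs.length (cs.wordProd ω)) :
    ∀ s ∈ J, cs.wordProd ω * s * (cs.wordProd ω)⁻¹ ∈ Simples cs := by
  intro s hs
  have hinv : (cs.wordProd ω)⁻¹ = cs.wordProd ω :=
    inv_eq_of_mul_eq_one_left (wordProd_mul_self_of_descents cs hω hd)
  have hlt := hd s hs
  obtain ⟨i, rfl⟩ := mem_simples.1 (hJ hs)
  have h1 := length_mul_wordProd_of_descents cs hd (i :: ω) (by simpa [hs] using hω)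
  have h2 : cs.length (cs.wordProd (i :: ω)) = cs.length (cs.wordProd ω * cs.simple i) := by
    rw [← cs.length_inv, cs.wordProd_cons, mul_inv_rev, cs.inv_simple, hinv]
  have h3 := cs.length_mul_simple (cs.wordProd ω) i
  rw [hinv, mul_assoc, ← cs.wordProd_cons]
  obtain ⟨k, hk⟩ := cs.length_eq_one_iff.1
    (show cs.length (cs.wordProd ω * cs.wordProd (i :: ω)) = 1 by omega)
  exact mem_simples.2 ⟨k, hk.symm⟩

/-- The longest element of `W_J` is the unique element with descent set `J` that conjugates `J`
into `S`. -/
theorem existsUnique_descents (cs : CoxeterSystem M W) {J : Finset W} (hJ : J ⊆ Simples cs) :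
    ∃! x : W, (∀ s ∈ Simples cs, cs.length (x * s) < cs.length x ↔ s ∈ J) ∧
      ∀ s ∈ J, x * s * x⁻¹ ∈ Simples cs := by
  obtain ⟨ω, hω, hd⟩ := exists_longest cs hJ
  have hsq := wordProd_mul_self_of_descents cs hω hd
  refine ⟨cs.wordProd ω, ⟨fun s hs => ⟨mem_of_descent cs hω hs, hd s⟩,
    conj_mem_simples_of_descents cs hJ hω hd⟩, ?_⟩
  rintro x ⟨hx, hc⟩
  have hxd : ∀ s ∈ J, cs.length (x * s) < cs.length x := fun s hs => (hx s (hJ hs)).2 hs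
  have hy := length_mul_wordProd_of_descents cs hxd ω hω
  suffices x * cs.wordProd ω = 1 by
    rw [eq_inv_of_mul_eq_one_left this, inv_eq_of_mul_eq_one_left hsq]
  by_contra hne
  obtain ⟨i, hi⟩ := cs.exists_rightDescent_of_ne_one hne
  have hi : cs.length (x * cs.wordProd ω * cs.simple i) < cs.length (x * cs.wordProd ω) := hi
  by_cases hiJ : cs.simple i ∈ J
  · have h1 := length_mul_wordProd_of_descents cs hxd (ω ++ [i]) (by
      intro k hk
      rcases List.mem_append.1 hk with hk | hk
      · exact hω k hk
      · rw [List.mem_singleton.1 hk]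
        exact hiJ)
    rw [cs.wordProd_append, cs.wordProd_singleton, ← mul_assoc] at h1
    have := hd _ hiJ
    omega
  · refine hiJ ((hx _ (mem_simples.2 ⟨i, rfl⟩)).1 ?_)
    have h1 := length_conj_wordProd_le cs hc ω hω
    have h2 := cs.length_mul_le (x * cs.wordProd ω * x⁻¹) (x * cs.wordProd ω * cs.simple i)
    rw [show x * cs.wordProd ω * x⁻¹ * (x * cs.wordProd ω * cs.simple i) =
      x * (cs.wordProd ω * cs.wordProd ω) * cs.simple i by simp only [mul_assoc,
        inv_mul_cancel_left], hsq, mul_one] at h2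
    omega

theorem ne_one_of_mem_simples (cs : CoxeterSystem M W) {s : W} (hs : s ∈ Simples cs) : s ≠ 1 := by
  obtain ⟨i, rfl⟩ := mem_simples.1 hs
  intro h
  simpa [h] using cs.length_simple i

/-- Left multiplication by the longest element complements lengths. -/
theorem length_longest_mul (cs : CoxeterSystem M W) {w0 : W}
    (hw0 : ∀ w : W, w ≠ w0 → cs.length w < cs.length w0) (x : W) :
    cs.length (w0 * x) + cs.length x = cs.length w0 := by
  obtain ⟨ω, rfl⟩ := cs.wordProd_surjective x
  refine length_mul_wordProd_of_descents cs (J := Simples cs) (fun s hs => hw0 _ fun h => ?_) ω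
    fun i _ => mem_simples.2 ⟨i, rfl⟩
  exact ne_one_of_mem_simples cs hs (mul_eq_left.1 h)

theorem longest_mul_self (cs : CoxeterSystem M W) {w0 : W}
    (hw0 : ∀ w : W, w ≠ w0 → cs.length w < cs.length w0) : w0 * w0 = 1 := by
  have := length_longest_mul cs hw0 w0
  exact cs.length_eq_zero_iff.1 (by omega)

theorem longest_conj_mem_simples (cs : CoxeterSystem M W) {w0 : W}
    (hw0 : ∀ w : W, w ≠ w0 → cs.length w < cs.length w0) {s : W} (hs : s ∈ Simples cs) :
    w0 * s * w0⁻¹ ∈ Simples cs := by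
  obtain ⟨ω, rfl⟩ := cs.wordProd_surjective w0
  refine conj_mem_simples_of_descents cs subset_rfl (fun i _ => mem_simples.2 ⟨i, rfl⟩)
    (fun s hs => hw0 _ fun h => ?_) s hs
  exact ne_one_of_mem_simples cs hs (mul_eq_left.1 h)

/-- There is exactly one element with ascent set `J` that maps `Δ_J` into `Δ`. -/
theorem existsUnique_ascents (cs : CoxeterSystem M W) {w0 : W}
    (hw0 : ∀ w : W, w ≠ w0 → cs.length w < cs.length w0) {J : Finset W} (hJ : J ⊆ Simples cs) :
    ∃! w : W, ascents cs w = J ∧ Takes cs (Simples cs) w J := by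
  have hsq := longest_mul_self cs hw0
  have hinv : w0⁻¹ = w0 := inv_eq_of_mul_eq_one_left hsq
  have key : ∀ w : W, (ascents cs w = J ∧ Takes cs (Simples cs) w J) ↔
      ((∀ s ∈ Simples cs, cs.length (w0 * w * s) < cs.length (w0 * w) ↔ s ∈ J) ∧
        ∀ s ∈ J, w0 * w * s * (w0 * w)⁻¹ ∈ Simples cs) := by
    intro w
    have hl : ∀ s, cs.length (w0 * w * s) < cs.length (w0 * w) ↔
        cs.length w < cs.length (w * s) := by
      intro s
      have h1 := length_longest_mul cs hw0 w
      have h2 := length_longest_mul cs hw0 (w * s)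
      rw [← mul_assoc] at h2
      omega
    have hc : ∀ s, w0 * w * s * (w0 * w)⁻¹ ∈ Simples cs ↔ w * s * w⁻¹ ∈ Simples cs := by
      intro s
      have h : w0 * w * s * (w0 * w)⁻¹ = w0 * (w * s * w⁻¹) * w0⁻¹ := by simp [mul_assoc]
      refine ⟨fun hs => ?_, fun hs => h ▸ longest_conj_mem_simples cs hw0 hs⟩
      rw [h] at hs
      have := longest_conj_mem_simples cs hw0 hs
      rwa [show w0 * (w0 * (w * s * w⁻¹) * w0⁻¹) * w0⁻¹ = w0 * w0 * (w * s * w⁻¹) * (w0 * w0)⁻¹ by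
        simp only [mul_assoc, mul_inv_rev], hsq, one_mul, inv_one, mul_one] at this
    simp only [hl, hc]
    constructor
    · rintro ⟨rfl, ht⟩
      exact ⟨fun s hs => by simp [ascents, hs], fun s hs => (ht s hs).1⟩
    · rintro ⟨ha, ht⟩
      refine ⟨?_, fun s hs => ⟨ht s hs, ?_⟩⟩
      · ext s
        rw [ascents, mem_filter]
        exact ⟨fun h => (ha s h.1).1 h.2, fun h => ⟨hJ h, (ha s (hJ h)).2 h⟩⟩
      · have h1 := (ha s (hJ hs)).2 hs
        obtain ⟨i, rfl⟩ := mem_simples.1 (hJ hs)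
        have := cs.length_mul_simple w i
        omega
  obtain ⟨x, hx, hu⟩ := existsUnique_descents cs hJ
  refine ⟨w0 * x, (key _).2 ?_, fun y hy => ?_⟩
  · rw [← mul_assoc, hsq, one_mul]
    exact hx
  · rw [← hu _ ((key y).1 hy), ← mul_assoc, hsq, one_mul]

/-- The longest element is the only element without ascents. -/
theorem ascents_eq_empty_iff (cs : CoxeterSystem M W) {w0 : W}
    (hw0 : ∀ w : W, w ≠ w0 → cs.length w < cs.length w0) (w : W) :
    ascents cs w = ∅ ↔ w = w0 := by
  obtain ⟨x, -, hu⟩ := existsUnique_ascents cs hw0 (empty_subset (Simples cs))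
  have h0 : ascents cs w0 = ∅ := by
    refine filter_eq_empty_iff.2 fun s hs => ?_
    have := hw0 (w0 * s) fun h => ne_one_of_mem_simples cs hs (mul_eq_left.1 h)
    omega
  refine ⟨fun h => ?_, fun h => h ▸ h0⟩
  rw [hu w ⟨h, by simp [Takes]⟩, hu w0 ⟨h0, by simp [Takes]⟩]

theorem sum_neg_one_pow_card_filter_subset {α : Type*} [DecidableEq α] {A J : Finset α} (hJ : J ⊆ A) :
    ∑ K ∈ A.powerset with J ⊆ K, (-1 : ℂ) ^ K.card = if A = J then (-1) ^ J.card else 0 := by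
  have h : ∑ K ∈ A.powerset with J ⊆ K, (-1 : ℂ) ^ K.card =
      ∑ L ∈ (A \ J).powerset, (-1) ^ J.card * (-1 : ℂ) ^ L.card := by
    refine sum_nbij' (fun K => K \ J) (fun L => J ∪ L) ?_ ?_ ?_ ?_ ?_
    · intro K hK
      simp only [mem_filter, mem_powerset] at hK ⊢
      exact sdiff_subset_sdiff hK.1 subset_rfl
    · intro L hL
      simp only [mem_filter, mem_powerset] at hL ⊢
      exact ⟨union_subset hJ (hL.trans sdiff_subset), subset_union_left⟩
    · intro K hK
      exact union_sdiff_of_subset (mem_filter.1 hK).2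
    · intro L hL
      refine union_sdiff_cancel_left ?_
      exact disjoint_sdiff.mono_right (mem_powerset.1 hL)
    · intro K hK
      rw [← pow_add, add_comm, card_sdiff_add_card_eq_card (mem_filter.1 hK).2]
  have h2 := congrArg (Int.cast : ℤ → ℂ) (sum_powerset_neg_one_pow_card (x := A \ J))
  push_cast at h2
  rw [h, ← mul_sum, h2]
  by_cases hA : A = J
  · simp [hA]
  · rw [if_neg hA, if_neg fun h => hA (subset_antisymm (sdiff_eq_empty_iff_subset.1 h) hJ),
      mul_zero]

/-- The alternating sum of the column of coefficients `m_{JK}` over `K`. -/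
theorem sum_neg_one_pow_mul_mC (cs : CoxeterSystem M W) {w0 : W}
    (hw0 : ∀ w : W, w ≠ w0 → cs.length w < cs.length w0) {J : Finset W} (hJ : J ⊆ Simples cs) :
    ∑ K ∈ (Simples cs).powerset,
      (-1 : ℂ) ^ K.card * (mC cs Set.univ (Simples cs) (fun _ => 1) J K : ℂ) = (-1) ^ J.card := by
  have h1 : ∀ K ∈ (Simples cs).powerset,
      (-1 : ℂ) ^ K.card * (mC cs Set.univ (Simples cs) (fun _ => 1) J K : ℂ) =
      ∑ w : W with Takes cs (Simples cs) w J,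
        if K ⊆ ascents cs w ∧ J ⊆ K then (-1 : ℂ) ^ K.card else 0 := by
    intro K hK
    have hm : (minCoset cs Set.univ K).filter (fun w => Takes cs (Simples cs) w J) =
        (univ.filter fun w => Takes cs (Simples cs) w J).filter fun w => K ⊆ ascents cs w := by
      ext w
      simp [mem_minCoset_univ_iff cs (mem_powerset.1 hK), and_comm]
    by_cases hJK : J ⊆ K
    · simp only [mC, hJK, if_true, and_true, hm]
      rw [← sum_filter]
      simp [mul_comm]
    · simp [mC, hJK]
  rw [sum_congr rfl h1, sum_comm]
  have h2 : ∀ w ∈ univ.filter (fun w : W => Takes cs (Simples cs) w J),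
      (∑ K ∈ (Simples cs).powerset, if K ⊆ ascents cs w ∧ J ⊆ K then (-1 : ℂ) ^ K.card else 0) =
      if ascents cs w = J then (-1) ^ J.card else 0 := by
    intro w hw
    have ht := (mem_filter.1 hw).2
    have hJa : J ⊆ ascents cs w := fun s hs =>
      mem_filter.2 ⟨hJ hs, by rw [(ht s hs).2]; exact Nat.lt_succ_self _⟩
    rw [← sum_neg_one_pow_card_filter_subset hJa, ← sum_filter]
    refine sum_congr ?_ fun _ _ => rfl
    ext K
    simp only [mem_filter, mem_powerset]
    exact ⟨fun h => h.2, fun h => ⟨h.1.trans (filter_subset _ _), h⟩⟩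
  rw [sum_congr rfl h2]
  obtain ⟨w, hw, hu⟩ := existsUnique_ascents cs hw0 hJ
  rw [sum_eq_single_of_mem w (mem_filter.2 ⟨mem_univ _, hw.2⟩), if_pos hw.1]
  intro v hv hne
  exact if_neg fun h => hne (hu v ⟨h, (mem_filter.1 hv).2⟩)

/-- The longest element is the alternating sum of the `x_K`. -/
theorem longest_eq_sum_xRel (cs : CoxeterSystem M W) {w0 : W}
    (hw0 : ∀ w : W, w ≠ w0 → cs.length w < cs.length w0) :
    of ℂ W w0 = ∑ K ∈ (Simples cs).powerset, (-1 : ℂ) ^ K.card • xRel cs Set.univ K := by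
  have h1 : ∀ K ∈ (Simples cs).powerset, (-1 : ℂ) ^ K.card • xRel cs Set.univ K =
      ∑ w : W, (if K ⊆ ascents cs w then (-1 : ℂ) ^ K.card else 0) • of ℂ W w := by
    intro K hK
    have hm : minCoset cs Set.univ K = univ.filter fun w => K ⊆ ascents cs w := by
      ext w
      simp [mem_minCoset_univ_iff cs (mem_powerset.1 hK)]
    simp only [xRel, hm, smul_sum, sum_filter, ite_smul, zero_smul, smul_ite, smul_zero]
  rw [sum_congr rfl h1, sum_comm]
  have h2 : ∀ w : W, (∑ K ∈ (Simples cs).powerset,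
      if K ⊆ ascents cs w then (-1 : ℂ) ^ K.card else 0) = if w = w0 then 1 else 0 := by
    intro w
    have h := sum_neg_one_pow_card_filter_subset (empty_subset (ascents cs w))
    simp only [ascents_eq_empty_iff cs hw0, card_empty, pow_zero] at h
    rw [← h, ← sum_filter]
    refine sum_congr ?_ fun _ _ => rfl
    ext K
    simp only [mem_filter, mem_powerset, empty_subset, and_true]
    exact ⟨fun h => h.2, fun h => ⟨h.trans (filter_subset _ _), h⟩⟩
  simp_rw [← sum_smul, h2]
  simp

/-- The longest element is the alternating sum of the quasi-idempotents. -/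
theorem longest_eq_sum_quasiIdempotent (cs : CoxeterSystem M W) {e : Finset W → MonoidAlgebra ℂ W}
    (he : IsBBHT cs Set.univ (Simples cs) (fun _ => (1 : ℝ)) e) {w0 : W}
    (hw0 : ∀ w : W, w ≠ w0 → cs.length w < cs.length w0) :
    of ℂ W w0 = ∑ L ∈ (Simples cs).powerset, (-1 : ℂ) ^ L.card • e L := by
  rw [longest_eq_sum_xRel cs hw0]
  have h1 : ∀ K ∈ (Simples cs).powerset, (-1 : ℂ) ^ K.card • xRel cs Set.univ K =
      ∑ J ∈ (Simples cs).powerset,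
        ((-1 : ℂ) ^ K.card * (mC cs Set.univ (Simples cs) (fun _ => 1) J K : ℂ)) • e J := by
    intro K hK
    rw [he K hK, smul_sum]
    simp only [smul_smul]
    refine sum_subset (powerset_mono.2 (mem_powerset.1 hK)) fun J _ hJK => ?_
    simp [mC, mt mem_powerset.2 hJK]
  rw [sum_congr rfl h1, sum_comm]
  refine sum_congr rfl fun J hJ => ?_
  rw [← sum_smul, sum_neg_one_pow_mul_mC cs hw0 (mem_powerset.1 hJ)]

/-- Lemma 3.3(a): the longest element `w₀` of `W` satisfies
`w₀ = ∑_{K ⊆ S} (−1)^{|K|} x_K = ∑_{L ⊆ S} (−1)^{|L|} e_L`; in particular `w₀`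
lies in Solomon's descent algebra, and `w₀ = ∑_{λ ∈ Λ} (−1)^{d_λ} e_λ`, where the
sum is over the shapes `λ` of `W` (the classes of any partition `P` of the power
set of `S` into shape-equivalence classes), `d_λ = |L|` for any `L ∈ S_λ`, and
`e_λ = ∑_{I ∈ S_λ} e_I`. -/
theorem stmt2 (cs : CoxeterSystem M W)
    (e : Finset W → MonoidAlgebra ℂ W)
    (he : IsBBHT cs Set.univ (Simples cs) (fun _ => (1 : ℝ)) e)
    (w0 : W) (hw0 : ∀ w : W, w ≠ w0 → cs.length w < cs.length w0) :
    (of ℂ W w0 = ∑ K ∈ (Simples cs).powerset, ((-1 : ℂ)) ^ K.card • xRel cs Set.univ K) ∧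
    (of ℂ W w0 = ∑ L ∈ (Simples cs).powerset, ((-1 : ℂ)) ^ L.card • e L) ∧
    (of ℂ W w0 ∈ descAlg cs) ∧
    (∀ P : Finset (Finset (Finset W)),
      (∀ I ∈ (Simples cs).powerset, ∃! cl, cl ∈ P ∧ I ∈ cl) →
      (∀ cl ∈ P, ∀ I ∈ cl, I ⊆ Simples cs) →
      (∀ cl ∈ P, ∀ I ∈ cl, ∀ J, J ⊆ Simples cs → (ShapeEq I J ↔ J ∈ cl)) →
      ∀ d : Finset (Finset W) → ℕ,
        (∀ cl ∈ P, ∀ I ∈ cl, I.card = d cl) →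
        of ℂ W w0 = ∑ cl ∈ P, ((-1 : ℂ)) ^ d cl • ∑ I ∈ cl, e I) := by
  have hx := longest_eq_sum_xRel cs hw0
  have hq := longest_eq_sum_quasiIdempotent cs he hw0
  refine ⟨hx, hq, ?_, fun P hP hsub _ d hd => ?_⟩
  · rw [hx]
    exact Submodule.sum_mem _ fun K hK =>
      Submodule.smul_mem _ _ (Submodule.subset_span ⟨K, hK, rfl⟩)
  · have hU : (Simples cs).powerset = P.biUnion id := by
      ext I
      simp only [mem_biUnion, id]
      constructor
      · intro hI
        obtain ⟨cl, hcl, -⟩ := hP I hI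
        exact ⟨cl, hcl⟩
      · rintro ⟨cl, hcl, hI⟩
        exact mem_powerset.2 (hsub cl hcl I hI)
    have hdisj : (P : Set (Finset (Finset W))).PairwiseDisjoint id := by
      intro cl hcl cl' hcl' hne
      refine disjoint_left.2 fun I hI hI' => hne ?_
      exact (hP I (mem_powerset.2 (hsub cl hcl I hI))).unique ⟨hcl, hI⟩ ⟨hcl', hI'⟩
    rw [hq, hU, sum_biUnion hdisj]
    refine sum_congr rfl fun cl hcl => ?_
    rw [smul_sum]
    exact sum_congr rfl fun I hI => by rw [hd cl hcl I hI]

end DPR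
end
end

section
/- Let σ : 2^S → ℝ_{>0} and L ⊆ S, and define σ_L : 2^L → ℝ_{>0} by σ_L(I) = m^σ_{IL}. Regard (W_L, L) as a Coxeter system in its own right, with x^L_I = ∑_{w ∈ W_L ∩ W^I} w for I ⊆ L, coefficients m^{σ_L}_{IJ} computed inside W_L (the defining conditions taken relative to W_L and L), and (e^{σ_L}_J)_{J ⊆ L} ⊆ ℂW_L ⊆ ℂW the unique family with x^L_K = ∑_{J ⊆ K} m^{σ_L}_{JK} e^{σ_L}_J for every K ⊆ L. Then for all I ⊆ J ⊆ L: (a) m^{σ_L}_{IJ} = m^σ_{IJ}; and (b) x_L · e^{σ_L}_J = e^σ_J in ℂW. -/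
open scoped Classical
open MonoidAlgebra Finset

noncomputable section

namespace DPR

variable {B : Type} {W : Type} [Group W] [Fintype W] [DecidableEq W]
  {M : CoxeterMatrix B}

/-! ### The exchange property -/

/-- The action of the simple reflection `s i` on `W × ℤ/2` that conjugates the first coordinate
by `s i` and flips the second one exactly at `s i`. -/
def flipSimple (cs : CoxeterSystem M W) (i : B) : Function.End (W × ZMod 2) :=
  fun p => (cs.simple i * p.1 * cs.simple i, p.2 + if p.1 = cs.simple i then 1 else 0)

theorem flipSimple_mul_pow_apply (cs : CoxeterSystem M W) (i j : B) (k : ℕ) (p : W × ZMod 2) :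
    ((flipSimple cs i * flipSimple cs j) ^ k) p =
      ((cs.simple i * cs.simple j) ^ k * p.1 * ((cs.simple i * cs.simple j) ^ k)⁻¹,
        p.2 + ∑ q ∈ Finset.range (2 * k),
          if p.1 = ((cs.simple i * cs.simple j) ^ q)⁻¹ * cs.simple j then 1 else 0) := by
  have hconj : ∀ q : ℕ, cs.simple j * (cs.simple i * cs.simple j) ^ q =
      ((cs.simple i * cs.simple j) ^ q)⁻¹ * cs.simple j := by
    intro q
    have h : SemiconjBy (cs.simple j) (cs.simple i * cs.simple j) (cs.simple i * cs.simple j)⁻¹ := by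
      simp [SemiconjBy, mul_assoc]
    rw [← inv_pow]
    exact h.pow_right q
  induction k with
  | zero => simp; rfl
  | succ k ih =>
    rw [pow_succ']
    change (flipSimple cs i) ((flipSimple cs j) (((flipSimple cs i * flipSimple cs j) ^ k) p)) = _
    rw [ih, show 2 * (k + 1) = 2 * k + 1 + 1 by ring, Finset.sum_range_succ, Finset.sum_range_succ]
    set c := cs.simple i * cs.simple j with hc
    have e1 : c ^ k * p.1 * (c ^ k)⁻¹ = cs.simple j ↔ p.1 = (c ^ (2 * k))⁻¹ * cs.simple j := by
      rw [mul_inv_eq_iff_eq_mul, hconj, ← eq_inv_mul_iff_mul_eq, two_mul, pow_add, mul_inv_rev,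
        mul_assoc]
    have e2 : cs.simple j * (c ^ k * p.1 * (c ^ k)⁻¹) * cs.simple j = cs.simple i ↔
        p.1 = (c ^ (2 * k + 1))⁻¹ * cs.simple j := by
      have h : cs.simple j * (c ^ k * p.1 * (c ^ k)⁻¹) * cs.simple j = cs.simple i ↔
          c ^ k * p.1 * (c ^ k)⁻¹ = c⁻¹ * cs.simple j := by
        rw [hc, mul_inv_rev, cs.inv_simple, cs.inv_simple]
        generalize (cs.simple i * cs.simple j) ^ k * p.1 * ((cs.simple i * cs.simple j) ^ k)⁻¹ = x
        constructor
        · intro h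
          rw [← h]
          simp [mul_assoc]
        · intro h
          rw [h]
          simp [mul_assoc]
      rw [h, mul_inv_eq_iff_eq_mul, mul_assoc, hconj, ← eq_inv_mul_iff_mul_eq,
        show 2 * k + 1 = k + 1 + k by ring, pow_add, pow_succ, mul_inv_rev (c ^ k * c),
        mul_inv_rev (c ^ k)]
      simp only [mul_assoc]
    simp only [flipSimple, e1, e2, Prod.mk.injEq]
    refine ⟨?_, by ring⟩
    rw [pow_succ', mul_inv_rev, hc, mul_inv_rev, cs.inv_simple, cs.inv_simple]
    simp only [mul_assoc]

theorem flipSimple_isLiftable (cs : CoxeterSystem M W) : M.IsLiftable (flipSimple cs) := by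
  intro i j
  funext p
  rw [flipSimple_mul_pow_apply, cs.simple_mul_simple_pow, two_mul, Finset.sum_range_add]
  simp only [pow_add, cs.simple_mul_simple_pow, one_mul, CharTwo.add_self_eq_zero]
  simp
  rfl

/-- The action of `W` on `W × ℤ/2` extending `flipSimple`. -/
def flipHom (cs : CoxeterSystem M W) : W →* Function.End (W × ZMod 2) :=
  cs.lift ⟨flipSimple cs, flipSimple_isLiftable cs⟩

theorem flipHom_wordProd (cs : CoxeterSystem M W) (ω : List B) (p : W × ZMod 2) :
    flipHom cs (cs.wordProd ω) p = (cs.wordProd ω * p.1 * (cs.wordProd ω)⁻¹,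
      p.2 + ((cs.rightInvSeq ω).count p.1 : ZMod 2)) := by
  induction ω with
  | nil => simp; rfl
  | cons i ω ih =>
    have h : flipHom cs (cs.simple i) = flipSimple cs i := cs.lift_apply_simple _ i
    rw [cs.wordProd_cons, map_mul, h]
    change flipSimple cs i (flipHom cs (cs.wordProd ω) p) = _
    rw [ih]
    have e : cs.wordProd ω * p.1 * (cs.wordProd ω)⁻¹ = cs.simple i ↔
        (cs.wordProd ω)⁻¹ * cs.simple i * cs.wordProd ω = p.1 := by
      constructor
      · intro h
        rw [← h]
        simp [mul_assoc]
      · intro h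
        rw [← h]
        simp [mul_assoc]
    simp only [flipSimple, CoxeterSystem.rightInvSeq, List.count_cons, e, beq_iff_eq,
      Prod.mk.injEq]
    constructor
    · simp [mul_assoc]
    · push_cast
      ring

theorem exchange (cs : CoxeterSystem M W) (ω : List B) (i : B)
    (h : cs.length (cs.wordProd ω * cs.simple i) < cs.length (cs.wordProd ω)) :
    ∃ j < ω.length, cs.wordProd ω * cs.simple i = cs.wordProd (ω.eraseIdx j) := by
  obtain ⟨ω', hω', hw⟩ := cs.exists_isReduced (cs.wordProd ω * cs.simple i)
  have hw' : cs.wordProd ω = cs.wordProd (ω' ++ [i]) := by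
    rw [cs.wordProd_append, ← hw]
    simp
  have h1 : cs.simple i ∉ cs.rightInvSeq ω' := by
    intro hmem
    have := (cs.isRightInversion_of_mem_rightInvSeq hω' hmem).2
    rw [← hw] at this
    simp at this
    omega
  have h2 : ((cs.rightInvSeq ω).count (cs.simple i) : ZMod 2) = 1 := by
    have e1 := flipHom_wordProd cs ω (cs.simple i, 0)
    have e2 := flipHom_wordProd cs ω' (cs.simple i, 0)
    rw [List.count_eq_zero_of_not_mem h1] at e2
    have e3 : flipHom cs (cs.wordProd ω) (cs.simple i, 0) =
        flipHom cs (cs.wordProd ω') (flipSimple cs i (cs.simple i, 0)) := by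
      rw [hw', cs.wordProd_append, cs.wordProd_singleton, map_mul,
        show flipHom cs (cs.simple i) = flipSimple cs i from cs.lift_apply_simple _ i]
      rfl
    have e4 : flipSimple cs i (cs.simple i, 0) = (cs.simple i, 1) := by
      simp [flipSimple]
    rw [e4, e1, flipHom_wordProd] at e3
    simpa [List.count_eq_zero_of_not_mem h1] using congrArg Prod.snd e3
  have h3 : cs.simple i ∈ cs.rightInvSeq ω := by
    by_contra hn
    rw [List.count_eq_zero_of_not_mem hn] at h2
    simp at h2
  obtain ⟨j, hj, hji⟩ := List.getElem_of_mem h3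
  refine ⟨j, by simpa using hj, ?_⟩
  rw [← cs.wordProd_mul_getD_rightInvSeq, List.getD_eq_getElem _ _ hj, hji]

/-! ### Parabolic subgroups and minimal coset representatives -/

theorem mem_minCoset (cs : CoxeterSystem M W) {H : Set W} {I : Finset W} {w : W} :
    w ∈ minCoset cs H I ↔ w ∈ H ∧ ∀ s ∈ I, cs.length w < cs.length (w * s) := by
  simp [minCoset]

theorem exists_word_of_mem_closure (cs : CoxeterSystem M W) {L : Finset W}
    (hL : L ⊆ Simples cs) {v : W} (hv : v ∈ Subgroup.closure (L : Set W)) :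
    ∃ ω : List B, (∀ i ∈ ω, cs.simple i ∈ L) ∧ cs.wordProd ω = v := by
  induction hv using Subgroup.closure_induction with
  | mem x hx =>
    obtain ⟨i, rfl⟩ := (Finset.mem_filter.1 (hL hx)).2
    exact ⟨[i], by simpa using hx, by simp⟩
  | one => exact ⟨[], by simp, by simp⟩
  | mul x y _ _ hx hy =>
    obtain ⟨a, ha, rfl⟩ := hx
    obtain ⟨b, hb, rfl⟩ := hy
    refine ⟨a ++ b, fun i hi => ?_, cs.wordProd_append a b⟩
    exact (List.mem_append.1 hi).elim (ha i) (hb i)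
  | inv x _ hx =>
    obtain ⟨a, ha, rfl⟩ := hx
    exact ⟨a.reverse, by simpa using ha, by simp⟩

theorem wordProd_mem_closure (cs : CoxeterSystem M W) {L : Finset W} {ω : List B}
    (hω : ∀ i ∈ ω, cs.simple i ∈ L) : cs.wordProd ω ∈ Subgroup.closure (L : Set W) := by
  refine Subgroup.list_prod_mem _ fun x hx => ?_
  obtain ⟨i, hi, rfl⟩ := List.mem_map.1 hx
  exact Subgroup.subset_closure (hω i hi)

theorem exists_shorter_word (cs : CoxeterSystem M W) {L : Finset W} {u : W}
    (hu : ∀ v ∈ Subgroup.closure (L : Set W), cs.length u ≤ cs.length (u * v))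
    (ω : List B) (hω : ∀ i ∈ ω, cs.simple i ∈ L)
    (h : cs.length (u * cs.wordProd ω) < cs.length u + ω.length) :
    ∃ ω' : List B, (∀ i ∈ ω', cs.simple i ∈ L) ∧ cs.wordProd ω' = cs.wordProd ω ∧
      ω'.length < ω.length := by
  induction ω using List.reverseRecOn with
  | nil => simp at h
  | append_singleton ω i ih =>
    have hω₁ : ∀ k ∈ ω, cs.simple k ∈ L := fun k hk => hω k (by simp [hk])
    have hi : cs.simple i ∈ L := hω i (by simp)
    by_cases hlt : cs.length (u * cs.wordProd ω) < cs.length u + ω.length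
    · obtain ⟨ω', h1, h2, h3⟩ := ih hω₁ hlt
      refine ⟨ω' ++ [i], fun k hk => ?_, by simp [cs.wordProd_append, h2], by simpa using h3⟩
      rcases List.mem_append.1 hk with hk | hk
      · exact h1 k hk
      · rw [List.mem_singleton.1 hk]
        exact hi
    · obtain ⟨α, hα, hαu⟩ := cs.exists_isReduced u
      have hdesc : cs.length (cs.wordProd (α ++ ω) * cs.simple i) <
          cs.length (cs.wordProd (α ++ ω)) := by
        have := cs.length_mul_simple (u * cs.wordProd ω) i
        rw [cs.wordProd_append, cs.wordProd_singleton, ← mul_assoc, List.length_append,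
          List.length_singleton] at h
        rw [cs.wordProd_append, ← hαu]
        omega
      obtain ⟨j, hj, hjeq⟩ := exchange cs _ i hdesc
      rw [cs.wordProd_append, ← hαu] at hjeq
      by_cases hjα : j < α.length
      · exfalso
        rw [List.eraseIdx_append_of_lt_length hjα, cs.wordProd_append] at hjeq
        have hmem := wordProd_mem_closure cs hω₁
        have hle := hu (cs.wordProd ω * cs.simple i * (cs.wordProd ω)⁻¹)
          (mul_mem (mul_mem hmem (Subgroup.subset_closure hi)) (inv_mem hmem))
        rw [← mul_assoc, ← mul_assoc, hjeq, mul_inv_cancel_right] at hle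
        have h1 := cs.length_wordProd_le (α.eraseIdx j)
        rw [List.length_eraseIdx_of_lt hjα] at h1
        have h2 : cs.length u = α.length := by rw [hαu]; exact hα
        omega
      · rw [not_lt] at hjα
        rw [List.eraseIdx_append_of_length_le hjα, cs.wordProd_append, ← hαu, mul_assoc,
          mul_right_inj] at hjeq
        rw [List.length_append] at hj
        refine ⟨ω.eraseIdx (j - α.length), fun k hk => hω₁ k (List.mem_of_mem_eraseIdx hk), ?_, ?_⟩
        · rw [← hjeq, cs.wordProd_append, cs.wordProd_singleton]
        · rw [List.length_eraseIdx_of_lt (by omega), List.length_append]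
          simp

theorem exists_word_length_add (cs : CoxeterSystem M W) {L : Finset W} (hL : L ⊆ Simples cs)
    {v : W} (hv : v ∈ Subgroup.closure (L : Set W)) :
    ∃ ω : List B, (∀ i ∈ ω, cs.simple i ∈ L) ∧ cs.wordProd ω = v ∧ cs.length v = ω.length ∧
      ∀ u, (∀ v ∈ Subgroup.closure (L : Set W), cs.length u ≤ cs.length (u * v)) →
        cs.length (u * v) = cs.length u + cs.length v := by
  have hex : ∃ n, ∃ ω : List B, (∀ i ∈ ω, cs.simple i ∈ L) ∧ cs.wordProd ω = v ∧ ω.length = n := by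
    obtain ⟨ω, h1, h2⟩ := exists_word_of_mem_closure cs hL hv
    exact ⟨_, ω, h1, h2, rfl⟩
  obtain ⟨ω, h1, h2, h3⟩ := Nat.find_spec hex
  have key : ∀ u, (∀ v ∈ Subgroup.closure (L : Set W), cs.length u ≤ cs.length (u * v)) →
      cs.length u + ω.length ≤ cs.length (u * v) := by
    intro u hu
    by_contra hlt
    rw [not_le, ← h2] at hlt
    obtain ⟨ω', h1', h2', h3'⟩ := exists_shorter_word cs hu ω h1 hlt
    exact Nat.find_min hex (h3 ▸ h3') ⟨ω', h1', h2'.trans h2, rfl⟩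
  have hlen : cs.length v = ω.length := by
    refine le_antisymm (h2 ▸ cs.length_wordProd_le ω) ?_
    simpa using key 1 (by simp)
  refine ⟨ω, h1, h2, hlen, fun u hu => le_antisymm (cs.length_mul_le u v) ?_⟩
  rw [hlen]
  exact key u hu

theorem mem_of_mem_closure_of_length_eq_one (cs : CoxeterSystem M W) {L : Finset W}
    (hL : L ⊆ Simples cs) {r : W} (hr : r ∈ Subgroup.closure (L : Set W))
    (h : cs.length r = 1) : r ∈ L := by
  obtain ⟨ω, h1, h2, h3, -⟩ := exists_word_length_add cs hL hr
  obtain ⟨i, rfl⟩ := List.length_eq_one_iff.1 (h3.symm.trans h)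
  rw [← h2, cs.wordProd_singleton]
  exact h1 i (by simp)

theorem exists_minimal_mul (cs : CoxeterSystem M W) (L : Finset W) (w : W) :
    ∃ u v, v ∈ Subgroup.closure (L : Set W) ∧ w = u * v ∧
      ∀ v ∈ Subgroup.closure (L : Set W), cs.length u ≤ cs.length (u * v) := by
  have hex : ∃ n, ∃ x ∈ Subgroup.closure (L : Set W), cs.length (w * x) = n :=
    ⟨_, 1, one_mem _, rfl⟩
  obtain ⟨x, hx, hxn⟩ := Nat.find_spec hex
  refine ⟨w * x, x⁻¹, inv_mem hx, by simp, fun v hv => ?_⟩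
  rw [hxn]
  exact Nat.find_min' hex ⟨x * v, mul_mem hx hv, by rw [mul_assoc]⟩

theorem length_mul_of_mem_minCoset (cs : CoxeterSystem M W) {L : Finset W} (hL : L ⊆ Simples cs)
    {u v : W} (hu : u ∈ minCoset cs Set.univ L) (hv : v ∈ Subgroup.closure (L : Set W)) :
    cs.length (u * v) = cs.length u + cs.length v := by
  have hu' := ((mem_minCoset cs).1 hu).2
  obtain ⟨u₀, x, hx, rfl, hmin⟩ := exists_minimal_mul cs L u
  suffices x = 1 by
    subst this
    obtain ⟨-, -, -, -, h⟩ := exists_word_length_add cs hL hv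
    rw [mul_one]
    exact h u₀ hmin
  obtain ⟨ω, h1, h2, h3, h4⟩ := exists_word_length_add cs hL hx
  rcases List.eq_nil_or_concat ω with rfl | ⟨ω', i, rfl⟩
  · rw [← h2, cs.wordProd_nil]
  · exfalso
    have hi : cs.simple i ∈ L := h1 i (by simp)
    have hlt := hu' _ hi
    rw [h4 u₀ hmin, mul_assoc] at hlt
    have e : x * cs.simple i = cs.wordProd ω' := by
      rw [← h2, cs.wordProd_concat, cs.simple_mul_simple_cancel_right]
    rw [e] at hlt
    rw [List.length_concat] at h3
    have := cs.length_mul_le u₀ (cs.wordProd ω')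
    have := cs.length_wordProd_le ω'
    omega

theorem exists_minCoset_mul (cs : CoxeterSystem M W) {L : Finset W} (hL : L ⊆ Simples cs) (w : W) :
    ∃ u ∈ minCoset cs Set.univ L, ∃ v ∈ Subgroup.closure (L : Set W), w = u * v := by
  obtain ⟨u, v, hv, rfl, hmin⟩ := exists_minimal_mul cs L w
  refine ⟨u, (mem_minCoset cs).2 ⟨Set.mem_univ _, fun s hs => ?_⟩, v, hv, rfl⟩
  obtain ⟨i, rfl⟩ := (Finset.mem_filter.1 (hL hs)).2
  exact lt_of_le_of_ne (hmin _ (Subgroup.subset_closure hs)) (cs.length_mul_simple_ne u i).symm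

theorem minCoset_mul_inj (cs : CoxeterSystem M W) {L : Finset W} (hL : L ⊆ Simples cs)
    {u u' v v' : W} (hu : u ∈ minCoset cs Set.univ L) (hu' : u' ∈ minCoset cs Set.univ L)
    (hv : v ∈ Subgroup.closure (L : Set W)) (hv' : v' ∈ Subgroup.closure (L : Set W))
    (h : u * v = u' * v') : u = u' ∧ v = v' := by
  have hx : v * v'⁻¹ ∈ Subgroup.closure (L : Set W) := mul_mem hv (inv_mem hv')
  have e1 : u * (v * v'⁻¹) = u' := by rw [← mul_assoc, h, mul_inv_cancel_right]
  have e2 : u' * (v * v'⁻¹)⁻¹ = u := by rw [← e1, mul_inv_cancel_right]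
  have l1 := length_mul_of_mem_minCoset cs hL hu hx
  have l2 := length_mul_of_mem_minCoset cs hL hu' (inv_mem hx)
  rw [e1] at l1
  rw [e2, cs.length_inv] at l2
  have hv1 : v * v'⁻¹ = 1 := cs.length_eq_zero_iff.1 (by omega)
  rw [hv1, mul_one] at e1
  exact ⟨e1, mul_inv_eq_one.1 hv1⟩

theorem mul_mem_minCoset_iff (cs : CoxeterSystem M W) {J L : Finset W} (hL : L ⊆ Simples cs)
    (hJ : J ⊆ L) {u v : W} (hu : u ∈ minCoset cs Set.univ L)
    (hv : v ∈ Subgroup.closure (L : Set W)) :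
    u * v ∈ minCoset cs Set.univ J ↔
      v ∈ minCoset cs ((Subgroup.closure (L : Set W) : Subgroup W) : Set W) J := by
  simp only [mem_minCoset, Set.mem_univ, SetLike.mem_coe, hv, true_and]
  refine forall₂_congr fun s hs => ?_
  rw [mul_assoc, length_mul_of_mem_minCoset cs hL hu hv, length_mul_of_mem_minCoset cs hL hu
    (mul_mem hv (Subgroup.subset_closure (hJ hs))), add_lt_add_iff_left]

/-- Summation over `W^J` factors through `W^J = W^L · (W_L ∩ W^J)`. -/
theorem sum_minCoset_eq (cs : CoxeterSystem M W) {J L : Finset W} (hL : L ⊆ Simples cs)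
    (hJ : J ⊆ L) {A : Type*} [AddCommMonoid A] (f : W → A) :
    ∑ w ∈ minCoset cs Set.univ J, f w =
      ∑ v ∈ minCoset cs ((Subgroup.closure (L : Set W) : Subgroup W) : Set W) J,
        ∑ u ∈ minCoset cs Set.univ L, f (u * v) := by
  have hmem : ∀ v ∈ minCoset cs ((Subgroup.closure (L : Set W) : Subgroup W) : Set W) J,
      v ∈ Subgroup.closure (L : Set W) := fun v hv => ((mem_minCoset cs).1 hv).1
  rw [← Finset.sum_product']
  symm
  refine Finset.sum_bij (fun p _ => p.2 * p.1) ?_ ?_ ?_ ?_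
  · rintro ⟨v, u⟩ h
    obtain ⟨hv, hu⟩ := Finset.mem_product.1 h
    exact (mul_mem_minCoset_iff cs hL hJ hu (hmem v hv)).2 hv
  · rintro ⟨v, u⟩ h ⟨v', u'⟩ h' e
    obtain ⟨hv, hu⟩ := Finset.mem_product.1 h
    obtain ⟨hv', hu'⟩ := Finset.mem_product.1 h'
    obtain ⟨rfl, rfl⟩ := minCoset_mul_inj cs hL hu hu' (hmem v hv) (hmem v' hv') e
    rfl
  · intro w hw
    obtain ⟨u, hu, v, hv, rfl⟩ := exists_minCoset_mul cs hL w
    exact ⟨(v, u), Finset.mem_product.2 ⟨(mul_mem_minCoset_iff cs hL hJ hu hv).1 hw, hu⟩, rfl⟩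
  · intros
    rfl

/-! ### The coefficients of the triangular system -/

theorem takes_mul_iff (cs : CoxeterSystem M W) {I J L : Finset W} (hL : L ⊆ Simples cs)
    (hI : I ⊆ J) (hJ : J ⊆ L) {u v : W} (hu : u ∈ minCoset cs Set.univ L)
    (hv : v ∈ minCoset cs ((Subgroup.closure (L : Set W) : Subgroup W) : Set W) J) :
    Takes cs (Simples cs) (u * v) I ↔
      Takes cs L v I ∧ Takes cs (Simples cs) u (conjF v I) := by
  obtain ⟨hvL, hvJ⟩ := (mem_minCoset cs).1 hv
  have hsL : ∀ s ∈ I, s ∈ Subgroup.closure (L : Set W) :=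
    fun s hs => Subgroup.subset_closure (hJ (hI hs))
  have hvs : ∀ s ∈ I, cs.length (v * s) = cs.length v + 1 := by
    intro s hs
    have := hvJ s (hI hs)
    obtain ⟨i, rfl⟩ := (Finset.mem_filter.1 (hL (hJ (hI hs)))).2
    have := cs.length_mul_simple v i
    omega
  have hconj : ∀ s, u * (v * s * v⁻¹) * u⁻¹ = u * v * s * (u * v)⁻¹ := fun s => by group
  constructor
  · intro h
    have hr : ∀ s ∈ I, v * s * v⁻¹ ∈ Subgroup.closure (L : Set W) :=
      fun s hs => mul_mem (mul_mem hvL (hsL s hs)) (inv_mem hvL)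
    have hone : ∀ s ∈ I, cs.length (v * s * v⁻¹) = 1 := by
      intro s hs
      obtain ⟨t, ht⟩ := (Finset.mem_filter.1 (h s hs).1).2
      have e : u * (v * s * v⁻¹) = cs.simple t * u := by
        rw [ht, ← hconj, inv_mul_cancel_right]
      have l1 := length_mul_of_mem_minCoset cs hL hu (hr s hs)
      have l2 := cs.length_mul_le (cs.simple t) u
      rw [cs.length_simple] at l2
      rw [e] at l1
      have hne : cs.length (v * s * v⁻¹) ≠ 0 := by
        rw [Ne, cs.length_eq_zero_iff, mul_inv_eq_one]
        intro h1
        have := hvs s hs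
        rw [h1] at this
        omega
      omega
    refine ⟨fun s hs => ⟨mem_of_mem_closure_of_length_eq_one cs hL (hr s hs) (hone s hs),
      hvs s hs⟩, fun r hrI => ?_⟩
    obtain ⟨s, hs, rfl⟩ := Finset.mem_image.1 hrI
    refine ⟨hconj s ▸ (h s hs).1, ?_⟩
    rw [length_mul_of_mem_minCoset cs hL hu (hr s hs), hone s hs]
  · rintro ⟨-, h2⟩ s hs
    refine ⟨hconj s ▸ (h2 _ (Finset.mem_image_of_mem _ hs)).1, ?_⟩
    rw [mul_assoc, length_mul_of_mem_minCoset cs hL hu (mul_mem hvL (hsL s hs)),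
      length_mul_of_mem_minCoset cs hL hu hvL, hvs s hs, add_assoc]

theorem conjF_mul (u v : W) (I : Finset W) : conjF (u * v) I = conjF u (conjF v I) := by
  rw [conjF, conjF, conjF, Finset.image_image]
  refine Finset.image_congr fun s _ => ?_
  simp only [Function.comp_apply]
  group

theorem mC_parabolic (cs : CoxeterSystem M W) (σ : Finset W → ℝ) {I J L : Finset W}
    (hL : L ⊆ Simples cs) (hI : I ⊆ J) (hJ : J ⊆ L) :
    mC cs ((Subgroup.closure (L : Set W) : Subgroup W) : Set W) L
        (fun I' => mC cs Set.univ (Simples cs) σ I' L) I J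
      = mC cs Set.univ (Simples cs) σ I J := by
  rw [mC, mC, if_pos hI, if_pos hI, Finset.sum_filter, Finset.sum_filter,
    sum_minCoset_eq cs hL hJ]
  refine Finset.sum_congr rfl fun v hv => ?_
  by_cases hT : Takes cs L v I
  · have hsub : conjF v I ⊆ L := fun r hr => by
      obtain ⟨s, hs, rfl⟩ := Finset.mem_image.1 hr
      exact (hT s hs).1
    rw [if_pos hT, mC, if_pos hsub, Finset.sum_filter]
    refine Finset.sum_congr rfl fun u hu => ?_
    simp only [takes_mul_iff cs hL hI hJ hu hv, hT, true_and, conjF_mul]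
  · rw [if_neg hT]
    refine (Finset.sum_eq_zero fun u hu => ?_).symm
    simp only [takes_mul_iff cs hL hI hJ hu hv, hT, false_and, if_false]

theorem mC_self_pos (cs : CoxeterSystem M W) {σ : Finset W → ℝ} (hσ : PosOn (Simples cs) σ)
    {J : Finset W} (hJ : J ⊆ Simples cs) : 0 < mC cs Set.univ (Simples cs) σ J J := by
  rw [mC, if_pos (Finset.Subset.refl J)]
  refine Finset.sum_pos (fun w hw => hσ _ (Finset.mem_powerset.2 fun r hr => ?_)) ⟨1, ?_⟩
  · obtain ⟨s, hs, rfl⟩ := Finset.mem_image.1 hr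
    exact ((Finset.mem_filter.1 hw).2 s hs).1
  · have h1 : ∀ s ∈ J, cs.length s = 1 := fun s hs => by
      obtain ⟨i, rfl⟩ := (Finset.mem_filter.1 (hJ hs)).2
      exact cs.length_simple i
    refine Finset.mem_filter.2 ⟨(mem_minCoset cs).2 ⟨Set.mem_univ _,
      fun s hs => ?_⟩, fun s hs => ⟨?_, ?_⟩⟩
    · simp [h1 s hs]
    · simpa using hJ hs
    · simp [h1 s hs]

theorem xRel_mul_xRel (cs : CoxeterSystem M W) {J L : Finset W} (hL : L ⊆ Simples cs)
    (hJ : J ⊆ L) :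
    xRel cs Set.univ L * xRel cs ((Subgroup.closure (L : Set W) : Subgroup W) : Set W) J =
      xRel cs Set.univ J := by
  rw [xRel, xRel, xRel, sum_minCoset_eq cs hL hJ, Finset.sum_mul_sum, Finset.sum_comm]
  simp only [map_mul]

/-- Lemma 3.5(a),(b): for `L ⊆ S` and `σ_L(I) = m^σ_{IL}`, the coefficients of the
BBHT system of the parabolic Coxeter system `(W_L, L)` (computed inside `W_L`, with
the restricted length function) satisfy `m^{σ_L}_{IJ} = m^σ_{IJ}` for `I ⊆ J ⊆ L`,
and `x_L e^{σ_L}_J = e^σ_J` for `J ⊆ L`. -/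
theorem stmt4 (cs : CoxeterSystem M W) (σ : Finset W → ℝ) (hσ : PosOn (Simples cs) σ)
    (L : Finset W) (hL : L ⊆ Simples cs)
    (e : Finset W → MonoidAlgebra ℂ W) (he : IsBBHT cs Set.univ (Simples cs) σ e)
    (eL : Finset W → MonoidAlgebra ℂ W)
    (heL : IsBBHT cs ((Subgroup.closure (L : Set W) : Subgroup W) : Set W) L
      (fun I => mC cs Set.univ (Simples cs) σ I L) eL) :
    (∀ I J : Finset W, I ⊆ J → J ⊆ L →
      mC cs ((Subgroup.closure (L : Set W) : Subgroup W) : Set W) L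
          (fun I' => mC cs Set.univ (Simples cs) σ I' L) I J
        = mC cs Set.univ (Simples cs) σ I J) ∧
    (∀ J : Finset W, J ⊆ L →
      xRel cs Set.univ L * eL J = e J) := by
  have ha := fun I J (hI : I ⊆ J) (hJ : J ⊆ L) => mC_parabolic cs σ (I := I) hL hI hJ
  refine ⟨ha, fun J hJ => ?_⟩
  induction J using Finset.strongInduction with
  | H J ih =>
    have h1 := he J (Finset.mem_powerset.2 (hJ.trans hL))
    have h2 : xRel cs Set.univ J = ∑ K ∈ J.powerset,
        (mC cs Set.univ (Simples cs) σ K J : ℂ) • (xRel cs Set.univ L * eL K) := by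
      rw [← xRel_mul_xRel cs hL hJ, heL J (Finset.mem_powerset.2 hJ), Finset.mul_sum]
      refine Finset.sum_congr rfl fun K hK => ?_
      rw [ha K J (Finset.mem_powerset.1 hK) hJ, mul_smul_comm]
    have hJJ : J ∈ J.powerset := Finset.mem_powerset_self J
    rw [h2, ← Finset.add_sum_erase _ _ hJJ, ← Finset.add_sum_erase _ _ hJJ] at h1
    have hrest : ∀ K ∈ J.powerset.erase J,
        (mC cs Set.univ (Simples cs) σ K J : ℂ) • (xRel cs Set.univ L * eL K) =
          (mC cs Set.univ (Simples cs) σ K J : ℂ) • e K := by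
      intro K hK
      obtain ⟨hne, hsub⟩ := Finset.mem_erase.1 hK
      have hKJ := Finset.mem_powerset.1 hsub
      rw [ih K (Finset.ssubset_iff_subset_ne.2 ⟨hKJ, hne⟩) (hKJ.trans hJ)]
    rw [Finset.sum_congr rfl hrest, add_left_inj] at h1
    exact smul_right_injective _
      (Complex.ofReal_ne_zero.2 (mC_self_pos cs hσ (hJ.trans hL)).ne') h1

end DPR
end
end
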